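/- arXiv:1209.6019 — 2 statements merged into one kernel-verified Lean document; each statement's English description precedes it below -/
import Mathlib

section
/- B^{m,i} satisfies the first Stembridge axiom: for every A ∈ B^{m,i}, every l ∈ {1,…,n} with e_l A ≠ 0, and every j ∈ {1,…,n} with j ≠ l, one has ε_j(e_l A) ≥ ε_j(A) and φ_j(e_l A) ≤ φ_j(A). -/
open Finset

namespace KR

/-- Arrays of integers indexed by (column, row). -/
abbrev Arr := ℕ → ℕ → ℤ

/-- A Dyck path from (1,i) to (i,n). -/
def IsDyck (n i : ℕ) (L : List (ℕ × ℕ)) : Prop :=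
  L ≠ [] ∧ L.head? = some (1, i) ∧ L.getLast? = some (i, n) ∧
    L.Chain' (fun β γ => γ = (β.1, β.2 + 1) ∨ γ = (β.1 + 1, β.2))

/-- Membership in the polytope `B^{m,i}`: nonnegative entries supported on the box
`1 ≤ p ≤ i`, `i ≤ q ≤ n`, with all Dyck path sums bounded by `m`. -/
def InB (n i m : ℕ) (A : Arr) : Prop :=
  (∀ p q, 1 ≤ p → p ≤ i → i ≤ q → q ≤ n → 0 ≤ A p q) ∧
  (∀ p q, ¬(1 ≤ p ∧ p ≤ i ∧ i ≤ q ∧ q ≤ n) → A p q = 0) ∧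
  (∀ L, IsDyck n i L → (L.map fun β => A β.1 β.2).sum ≤ (m : ℤ))

/-- The sum `Σ_{j=1}^{p} a_{j,l−1} + Σ_{j=p}^{i} a_{j,l}` (used for `l > i`). -/
def Fp (i : ℕ) (A : Arr) (l p : ℕ) : ℤ :=
  ∑ j ∈ Icc 1 p, A j (l - 1) + ∑ j ∈ Icc p i, A j l

/-- `p_+^l(A)`: minimal maximizer of `Fp` on `{1,…,i}`. -/
noncomputable def pplus (i : ℕ) (A : Arr) (l : ℕ) : ℕ :=
  sInf {p | p ∈ Icc 1 i ∧ ∀ q ∈ Icc 1 i, Fp i A l q ≤ Fp i A l p}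

/-- `q_+^l(A)`: maximal maximizer of `Fp` on `{1,…,i}`. -/
noncomputable def qplus (i : ℕ) (A : Arr) (l : ℕ) : ℕ :=
  sSup {p | p ∈ Icc 1 i ∧ ∀ q ∈ Icc 1 i, Fp i A l q ≤ Fp i A l p}

/-- The sum `Σ_{j=i}^{p} a_{l,j} + Σ_{j=p}^{n} a_{l+1,j}` (used for `l < i`). -/
def Fm (n i : ℕ) (A : Arr) (l p : ℕ) : ℤ :=
  ∑ j ∈ Icc i p, A l j + ∑ j ∈ Icc p n, A (l + 1) j

/-- `p_−^l(A)`: maximal maximizer of `Fm` on `{i,…,n}`. -/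
noncomputable def pminus (n i : ℕ) (A : Arr) (l : ℕ) : ℕ :=
  sSup {p | p ∈ Icc i n ∧ ∀ q ∈ Icc i n, Fm n i A l q ≤ Fm n i A l p}

/-- `q_−^l(A)`: minimal maximizer of `Fm` on `{i,…,n}`. -/
noncomputable def qminus (n i : ℕ) (A : Arr) (l : ℕ) : ℕ :=
  sInf {p | p ∈ Icc i n ∧ ∀ q ∈ Icc i n, Fm n i A l q ≤ Fm n i A l p}

/-- `φ_l(A)` (depending on the parameter `m` only when `l = i`). -/
noncomputable def phi (n i m : ℕ) (l : ℕ) (A : Arr) : ℤ :=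
  if l = i then (m : ℤ) - ∑ j ∈ Icc 1 (i - 1), A j i - ∑ j ∈ Icc i n, A i j
  else if i < l then
    ∑ j ∈ Icc 1 (pplus i A l), A j (l - 1) - ∑ j ∈ Icc 1 (pplus i A l - 1), A j l
  else
    ∑ j ∈ Icc (pminus n i A l) n, A (l + 1) j - ∑ j ∈ Icc (pminus n i A l + 1) n, A l j

/-- `ε_l(A)` (the parameter `m` is carried along for uniformity; it is not used). -/
noncomputable def eps (n i m : ℕ) (l : ℕ) (A : Arr) : ℤ :=
  if l = i then A i i
  else if i < l then
    ∑ j ∈ Icc (qplus i A l) i, A j l - ∑ j ∈ Icc (qplus i A l + 1) i, A j (l - 1)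
  else
    ∑ j ∈ Icc i (qminus n i A l), A l j - ∑ j ∈ Icc i (qminus n i A l - 1), A (l + 1) j

/-- Update a single entry of an array. -/
def upd (A : Arr) (p q : ℕ) (v : ℤ) : Arr :=
  fun p' q' => if p' = p ∧ q' = q then v else A p' q'

/-- The Kashiwara operator `f_l` (with `none` playing the role of `0`). -/
noncomputable def fop (n i m : ℕ) (l : ℕ) (A : Arr) : Option Arr :=
  if phi n i m l A = 0 then none
  else some <|
    if l = i then upd A i i (A i i + 1)
    else if i < l then
      upd (upd A (pplus i A l) (l - 1) (A (pplus i A l) (l - 1) - 1))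
        (pplus i A l) l (A (pplus i A l) l + 1)
    else
      upd (upd A l (pminus n i A l) (A l (pminus n i A l) + 1))
        (l + 1) (pminus n i A l) (A (l + 1) (pminus n i A l) - 1)

/-- The Kashiwara operator `e_l` (with `none` playing the role of `0`). -/
noncomputable def eop (n i m : ℕ) (l : ℕ) (A : Arr) : Option Arr :=
  if eps n i m l A = 0 then none
  else some <|
    if l = i then upd A i i (A i i - 1)
    else if i < l then
      upd (upd A (qplus i A l) (l - 1) (A (qplus i A l) (l - 1) + 1))
        (qplus i A l) l (A (qplus i A l) l - 1)
    else
      upd (upd A l (qminus n i A l) (A l (qminus n i A l) - 1))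
        (l + 1) (qminus n i A l) (A (l + 1) (qminus n i A l) + 1)

/-- Coefficient of `ω_j` in the simple root `α_r` (column `r` of the Cartan matrix). -/
def cart (j r : ℕ) : ℤ :=
  if r = j then 2 else if r = j + 1 ∨ j = r + 1 then -1 else 0

/-- The weight `wt(A) = mω_i − Σ a_{p,q} α_{p,q}`, expressed in the basis of
fundamental weights: `wtv n i m A j` is the coefficient of `ω_j`. -/
def wtv (n i m : ℕ) (A : Arr) (j : ℕ) : ℤ :=
  (m : ℤ) * (if j = i then 1 else 0) -
    ∑ p ∈ Icc 1 i, ∑ q ∈ Icc i n, A p q * ∑ r ∈ Icc p q, cart j r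

/-- The coefficient `c_l(p,q)` of the pairing `⟨α_l^∨, α_{p,q}⟩`. -/
def clpq (l p q : ℕ) : ℤ :=
  if p = l ∧ q = l then 2
  else if (l = p ∧ p < q) ∨ (p < q ∧ q = l) then 1
  else if l + 1 = p ∨ l = q + 1 then -1
  else 0

/-- The pairing `⟨α_l^∨, wt(A)⟩ = m·δ_{l,i} − Σ_{p,q} a_{p,q}·c_l(p,q)`. -/
def pairing (n i m : ℕ) (l : ℕ) (A : Arr) : ℤ :=
  (m : ℤ) * (if l = i then 1 else 0) -
    ∑ p ∈ Icc 1 i, ∑ q ∈ Icc i n, A p q * clpq l p q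

/-! ### The promotion algorithm -/

/-- Columns, indexed by rows `i,…,n`. -/
abbrev Col := ℕ → ℤ

/-- `Σ_{j=lo}^{p} a_j + Σ_{j=p}^{n} b_j`. -/
def Gc (n lo : ℕ) (a b : Col) (p : ℕ) : ℤ := ∑ j ∈ Icc lo p, a j + ∑ j ∈ Icc p n, b j

/-- `q_−` for two (truncated) columns with rows `lo,…,n`: the minimal maximizer of `Gc`. -/
noncomputable def qmc (n lo : ℕ) (a b : Col) : ℕ :=
  if lo ≤ n then
    max lo (sInf {p | p ∈ Icc lo n ∧ ∀ q ∈ Icc lo n, Gc n lo a b q ≤ Gc n lo a b p})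
  else n

/-- `ε` for two (truncated) columns with rows `lo,…,n`. -/
noncomputable def epsc (n lo : ℕ) (a b : Col) : ℤ :=
  ∑ j ∈ Icc lo (qmc n lo a b), a j - ∑ j ∈ Icc lo (qmc n lo a b - 1), b j

/-- The sequence `l_1 < l_2 < ⋯` of the promotion algorithm:
`l_1 = q_−(a,c)` and `l_{s+1} = q_−((a)^{≥ l_s + 1}, (c)^{≥ l_s + 1})`,
stabilizing at `n`. -/
noncomputable def lfun (n i : ℕ) (a c : Col) : ℕ → ℕ
  | 0 => qmc n i a c
  | s + 1 => qmc n (lfun n i a c s + 1) a c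

/-- The set `{l_1, …, l_t}` (with `l_t = n`). -/
noncomputable def lset (n i : ℕ) (a c : Col) : Finset ℕ := (Finset.range (n + 1)).image (lfun n i a c)

/-- The new column `ĉ` of formula (6.2). -/
noncomputable def hatc (n i : ℕ) (a c : Col) : Col := fun r =>
  if r = n then a n + c n
  else if r ∈ lset n i a c then a r + c r - epsc n (r + 1) a c
  else a r

/-- The output column of one step of the promotion algorithm. -/
noncomputable def prcol (n i : ℕ) (a c : Col) : Col := fun r =>
  if r = i then epsc n i a c
  else if r - 1 ∈ lset n i a c then epsc n r a c
  else c (r - 1)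

/-- The running columns of the promotion algorithm: `cseq 0` is the `i`-th column of `A`,
and `cseq (k+1)` is obtained from the `(i−1−k)`-th column of `A` and `cseq k`. -/
noncomputable def cseq (n i : ℕ) (A : Arr) : ℕ → Col
  | 0 => fun r => A i r
  | k + 1 => hatc n i (fun r => A (i - 1 - k) r) (cseq n i A k)

/-- The `j`-th column of `pr(A)` for `2 ≤ j ≤ i`. -/
noncomputable def prColJ (n i : ℕ) (A : Arr) (j : ℕ) : Col :=
  prcol n i (fun q => A (j - 1) q) (cseq n i A (i - j))

/-- The promotion map `pr` on `B^{m,i}`. -/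
noncomputable def prMap (n i m : ℕ) (A : Arr) : Arr := fun p r =>
  if 1 ≤ p ∧ p ≤ i ∧ i ≤ r ∧ r ≤ n then
    if p = 1 then
      if r = i then
        (m : ℤ) - (∑ j ∈ Icc i n, A i j) - ∑ j ∈ Icc 2 i, prColJ n i A j i
      else
        (∑ j ∈ Icc 1 i, A j (r - 1)) - ∑ j ∈ Icc 2 i, prColJ n i A j r
    else prColJ n i A p r
  else 0

/-- The content `(r_1,…,r_{n+1})` of an array. -/
def cont (n i m : ℕ) (A : Arr) (k : ℕ) : ℤ :=
  if k ≤ i then (m : ℤ) - ∑ q ∈ Icc i n, A k q else ∑ p ∈ Icc 1 i, A p (k - 1)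

/-- `B` is obtained from `A` by adding `s` at `(a, b)` and `t` at `(c, d)`. -/
def IsPerturb (A B : Arr) (a b : ℕ) (s : ℤ) (c d : ℕ) (t : ℤ) : Prop :=
  ∀ p q, B p q = A p q + (if p = a ∧ q = b then s else 0) + (if p = c ∧ q = d then t else 0)

lemma sum_Icc_ite (x y a : ℕ) (P : Prop) [Decidable P] (s : ℤ) :
    ∑ j ∈ Icc x y, (if j = a ∧ P then s else 0) = if (x ≤ a ∧ a ≤ y) ∧ P then s else 0 := by
  by_cases hP : P <;> simp [hP, Finset.sum_ite_eq']

namespace IsPerturb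

variable {A B : Arr} {a b c d : ℕ} {s t : ℤ}

lemma sum_row (h : IsPerturb A B a b s c d t) (x y r : ℕ) :
    ∑ j ∈ Icc x y, B j r = ∑ j ∈ Icc x y, A j r + (if (x ≤ a ∧ a ≤ y) ∧ r = b then s else 0)
      + (if (x ≤ c ∧ c ≤ y) ∧ r = d then t else 0) := by
  simp only [h _ r, Finset.sum_add_distrib, sum_Icc_ite]

lemma sum_col (h : IsPerturb A B a b s c d t) (x y r : ℕ) :
    ∑ j ∈ Icc x y, B r j = ∑ j ∈ Icc x y, A r j + (if (x ≤ b ∧ b ≤ y) ∧ r = a then s else 0)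
      + (if (x ≤ d ∧ d ≤ y) ∧ r = c then t else 0) := by
  simp only [h r, Finset.sum_add_distrib, and_comm (a := r = _), sum_Icc_ite]

end IsPerturb

lemma exists_maximizer (F : ℕ → ℤ) {x y : ℕ} (h : x ≤ y) :
    {p | p ∈ Icc x y ∧ ∀ q ∈ Icc x y, F q ≤ F p}.Nonempty :=
  Finset.exists_max_image (Icc x y) F ⟨x, by simp [h]⟩

lemma sSup_maximizer_mem (F : ℕ → ℤ) {x y : ℕ} (h : x ≤ y) :
    sSup {p | p ∈ Icc x y ∧ ∀ q ∈ Icc x y, F q ≤ F p} ∈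
      {p | p ∈ Icc x y ∧ ∀ q ∈ Icc x y, F q ≤ F p} :=
  Nat.sSup_mem (exists_maximizer F h) ⟨y, fun _ hp => (Finset.mem_Icc.1 hp.1).2⟩

lemma lt_of_sSup_maximizer_lt (F : ℕ → ℤ) {x y p : ℕ} (h : x ≤ y)
    (hp : sSup {p | p ∈ Icc x y ∧ ∀ q ∈ Icc x y, F q ≤ F p} < p) (hpy : p ≤ y) :
    F p < F (sSup {p | p ∈ Icc x y ∧ ∀ q ∈ Icc x y, F q ≤ F p}) := by
  have hm := sSup_maximizer_mem F h
  by_contra! hc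
  have hx := (Finset.mem_Icc.1 hm.1).1
  have := le_csSup (s := {p | p ∈ Icc x y ∧ ∀ q ∈ Icc x y, F q ≤ F p})
    ⟨y, fun _ hp => (Finset.mem_Icc.1 hp.1).2⟩
    (show p ∈ _ from ⟨Finset.mem_Icc.2 ⟨by omega, hpy⟩, fun q hq => (hm.2 q hq).trans hc⟩)
  omega

lemma lt_of_lt_sInf_maximizer (F : ℕ → ℤ) {x y p : ℕ} (h : x ≤ y)
    (hp : p < sInf {p | p ∈ Icc x y ∧ ∀ q ∈ Icc x y, F q ≤ F p}) (hxp : x ≤ p) :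
    F p < F (sInf {p | p ∈ Icc x y ∧ ∀ q ∈ Icc x y, F q ≤ F p}) := by
  have hm := Nat.sInf_mem (exists_maximizer F h)
  by_contra! hc
  have hy := (Finset.mem_Icc.1 hm.1).2
  exact Nat.notMem_of_lt_sInf hp
    ⟨Finset.mem_Icc.2 ⟨hxp, by omega⟩, fun q hq => (hm.2 q hq).trans hc⟩

lemma sum_Icc_split (f : ℕ → ℤ) {x y p : ℕ} (hx : x ≤ p + 1) (hy : p ≤ y) :
    ∑ j ∈ Icc x p, f j + ∑ j ∈ Icc (p + 1) y, f j = ∑ j ∈ Icc x y, f j := by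
  rw [← Finset.sum_union]
  · congr 1; ext j; simp only [Finset.mem_union, Finset.mem_Icc]; omega
  · rw [Finset.disjoint_left]; intro j; simp only [Finset.mem_Icc]; omega

lemma sum_Icc_pred_split (f : ℕ → ℤ) {x y p : ℕ} (hx : x ≤ p) (hp : 1 ≤ p) (hy : p ≤ y + 1) :
    ∑ j ∈ Icc x (p - 1), f j + ∑ j ∈ Icc p y, f j = ∑ j ∈ Icc x y, f j := by
  obtain ⟨k, rfl⟩ : ∃ k, p = k + 1 := ⟨p - 1, by omega⟩
  exact sum_Icc_split f hx (by omega)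

lemma Fp_succ (i : ℕ) (A : Arr) (l p : ℕ) (hpi : p < i) :
    Fp i A l (p + 1) + A p l = Fp i A l p + A (p + 1) (l - 1) := by
  have h1 := sum_Icc_split (fun j => A j l) (x := p) (y := i) (p := p) (by omega) (by omega)
  have h2 := Finset.sum_Icc_succ_top (a := 1) (b := p) (by omega) (fun j => A j (l - 1))
  simp only [Finset.Icc_self, Finset.sum_singleton] at h1
  unfold Fp
  linarith

lemma Fm_succ (n i : ℕ) (A : Arr) (l p : ℕ) (hip : i ≤ p) (hpn : p < n) :
    Fm n i A l (p + 1) + A (l + 1) p = Fm n i A l p + A l (p + 1) := by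
  have h1 := sum_Icc_split (fun j => A (l + 1) j) (x := p) (y := n) (p := p)
    (by omega) (by omega)
  have h2 := Finset.sum_Icc_succ_top (a := i) (b := p) (by omega) (fun j => A l j)
  simp only [Finset.Icc_self, Finset.sum_singleton] at h1
  unfold Fm
  linarith

section

variable (n i m : ℕ) (A : Arr) (l : ℕ)

lemma qplus_mem (hi : 1 ≤ i) :
    qplus i A l ∈ Icc 1 i ∧ ∀ q ∈ Icc 1 i, Fp i A l q ≤ Fp i A l (qplus i A l) :=
  sSup_maximizer_mem (Fp i A l) hi

lemma pplus_mem (hi : 1 ≤ i) :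
    pplus i A l ∈ Icc 1 i ∧ ∀ q ∈ Icc 1 i, Fp i A l q ≤ Fp i A l (pplus i A l) :=
  Nat.sInf_mem (exists_maximizer (Fp i A l) hi)

lemma pminus_mem (hin : i ≤ n) :
    pminus n i A l ∈ Icc i n ∧ ∀ q ∈ Icc i n, Fm n i A l q ≤ Fm n i A l (pminus n i A l) :=
  sSup_maximizer_mem (Fm n i A l) hin

lemma qminus_mem (hin : i ≤ n) :
    qminus n i A l ∈ Icc i n ∧ ∀ q ∈ Icc i n, Fm n i A l q ≤ Fm n i A l (qminus n i A l) :=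
  Nat.sInf_mem (exists_maximizer (Fm n i A l) hin)

lemma eps_eq_Fp_sub (hi : 1 ≤ i) (hil : i < l) :
    eps n i m l A = Fp i A l (qplus i A l) - ∑ j ∈ Icc 1 i, A j (l - 1) := by
  have hq := Finset.mem_Icc.1 (qplus_mem i A l hi).1
  rw [eps, if_neg hil.ne', if_pos hil, Fp,
    ← sum_Icc_split (fun j => A j (l - 1)) (x := 1) (p := qplus i A l) (by omega) hq.2]
  ring

lemma phi_eq_Fp_sub (hi : 1 ≤ i) (hil : i < l) :
    phi n i m l A = Fp i A l (pplus i A l) - ∑ j ∈ Icc 1 i, A j l := by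
  have hq := Finset.mem_Icc.1 (pplus_mem i A l hi).1
  rw [phi, if_neg hil.ne', if_pos hil, Fp,
    ← sum_Icc_pred_split (fun j => A j l) (x := 1) (y := i) (p := pplus i A l)
      hq.1 hq.1 (by omega)]
  ring

lemma eps_eq_Fm_sub (hin : i ≤ n) (hil : l < i) :
    eps n i m l A = Fm n i A l (qminus n i A l) - ∑ j ∈ Icc i n, A (l + 1) j := by
  have hq := Finset.mem_Icc.1 (qminus_mem n i A l hin).1
  rw [eps, if_neg hil.ne, if_neg hil.not_gt, Fm,
    ← sum_Icc_pred_split (fun j => A (l + 1) j) (x := i) (y := n) (p := qminus n i A l) hq.1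
      (by omega) (by omega)]
  ring

lemma phi_eq_Fm_sub (hin : i ≤ n) (hil : l < i) :
    phi n i m l A = Fm n i A l (pminus n i A l) - ∑ j ∈ Icc i n, A l j := by
  have hq := Finset.mem_Icc.1 (pminus_mem n i A l hin).1
  rw [phi, if_neg hil.ne, if_neg hil.not_gt, Fm,
    ← sum_Icc_split (fun j => A l j) (x := i) (p := pminus n i A l) (by omega) hq.2]
  ring

/-- To compare `ε_l` and `φ_l` for `l > i`, it suffices to compare the normalized sums `Fp`. -/
lemma eps_le_and_phi_le_of_Fp (B : Arr) (hi : 1 ≤ i) (hil : i < l)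
    (he : ∀ p ∈ Icc 1 i, ∃ q ∈ Icc 1 i,
      Fp i A l p - ∑ j ∈ Icc 1 i, A j (l - 1) ≤ Fp i B l q - ∑ j ∈ Icc 1 i, B j (l - 1))
    (hf : ∀ p ∈ Icc 1 i, ∃ q ∈ Icc 1 i,
      Fp i B l p - ∑ j ∈ Icc 1 i, B j l ≤ Fp i A l q - ∑ j ∈ Icc 1 i, A j l) :
    eps n i m l A ≤ eps n i m l B ∧ phi n i m l B ≤ phi n i m l A := by
  constructor
  · rw [eps_eq_Fp_sub _ _ _ _ _ hi hil, eps_eq_Fp_sub _ _ _ _ _ hi hil]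
    obtain ⟨q, hq, h⟩ := he _ (qplus_mem i A l hi).1
    linarith [(qplus_mem i B l hi).2 q hq]
  · rw [phi_eq_Fp_sub _ _ _ _ _ hi hil, phi_eq_Fp_sub _ _ _ _ _ hi hil]
    obtain ⟨q, hq, h⟩ := hf _ (pplus_mem i B l hi).1
    linarith [(pplus_mem i A l hi).2 q hq]

/-- To compare `ε_l` and `φ_l` for `l < i`, it suffices to compare the normalized sums `Fm`. -/
lemma eps_le_and_phi_le_of_Fm (B : Arr) (hin : i ≤ n) (hil : l < i)
    (he : ∀ p ∈ Icc i n, ∃ q ∈ Icc i n,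
      Fm n i A l p - ∑ j ∈ Icc i n, A (l + 1) j ≤ Fm n i B l q - ∑ j ∈ Icc i n, B (l + 1) j)
    (hf : ∀ p ∈ Icc i n, ∃ q ∈ Icc i n,
      Fm n i B l p - ∑ j ∈ Icc i n, B l j ≤ Fm n i A l q - ∑ j ∈ Icc i n, A l j) :
    eps n i m l A ≤ eps n i m l B ∧ phi n i m l B ≤ phi n i m l A := by
  constructor
  · rw [eps_eq_Fm_sub _ _ _ _ _ hin hil, eps_eq_Fm_sub _ _ _ _ _ hin hil]
    obtain ⟨q, hq, h⟩ := he _ (qminus_mem n i A l hin).1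
    linarith [(qminus_mem n i B l hin).2 q hq]
  · rw [phi_eq_Fm_sub _ _ _ _ _ hin hil, phi_eq_Fm_sub _ _ _ _ _ hin hil]
    obtain ⟨q, hq, h⟩ := hf _ (pminus_mem n i B l hin).1
    linarith [(pminus_mem n i A l hin).2 q hq]

end

section

variable {n i m l j : ℕ} {A B : Arr}

lemma stembridge_of_eop_center (hi : 1 ≤ i) (hin : i ≤ n) (hji : j ≠ i)
    (h : IsPerturb A B i i (-1) 0 0 0) :
    eps n i m j A ≤ eps n i m j B ∧ phi n i m j B ≤ phi n i m j A := by
  rcases hji.lt_or_gt with hj | hj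
  · apply eps_le_and_phi_le_of_Fm _ _ _ _ _ _ hin hj <;> intro p hp <;>
      refine ⟨p, hp, ?_⟩ <;> rw [Finset.mem_Icc] at hp <;>
      simp only [Fm, h.sum_col] <;> split_ifs <;> omega
  · apply eps_le_and_phi_le_of_Fp _ _ _ _ _ _ hi hj <;> intro p hp <;>
      refine ⟨p, hp, ?_⟩ <;> rw [Finset.mem_Icc] at hp <;>
      simp only [Fp, h.sum_row] <;> split_ifs <;> omega

lemma stembridge_of_eop_right {q : ℕ} (hi : 1 ≤ i) (hil : i < l) (hln : l ≤ n) (hj1 : 1 ≤ j)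
    (hjl : j ≠ l) (hq1 : 1 ≤ q) (hqi : q ≤ i)
    (hpred : ∀ p, 1 ≤ p → p + 1 = q → A p l ≤ A (p + 1) (l - 1))
    (hsucc : q < i → A (q + 1) (l - 1) < A q l)
    (h : IsPerturb A B q (l - 1) 1 q l (-1)) :
    eps n i m j A ≤ eps n i m j B ∧ phi n i m j B ≤ phi n i m j A := by
  have hin : i ≤ n := by omega
  rcases lt_trichotomy j i with hj | rfl | hj
  · have hstep := Fm_succ n i A j (l - 1) (by omega) (by omega)
    rw [show l - 1 + 1 = l by omega] at hstep
    apply eps_le_and_phi_le_of_Fm _ _ _ _ _ _ hin hj <;> intro p hp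
    · by_cases hc : p = l ∧ j + 1 = q
      · obtain ⟨rfl, hc⟩ := hc
        have := hpred j hj1 hc
        refine ⟨p - 1, by rw [Finset.mem_Icc]; omega, ?_⟩
        have : Fm n i A j p ≤ Fm n i A j (p - 1) := by linarith
        refine (sub_le_sub_right this _).trans ?_
        simp only [Fm, h.sum_col]
        split_ifs <;> omega
      · refine ⟨p, hp, ?_⟩
        rw [Finset.mem_Icc] at hp
        simp only [Fm, h.sum_col]
        split_ifs <;> omega
    · by_cases hc : p = l - 1 ∧ j = q
      · obtain ⟨rfl, rfl⟩ := hc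
        have := hsucc hj
        refine ⟨l, by rw [Finset.mem_Icc]; omega, ?_⟩
        have : Fm n i A j (l - 1) + 1 ≤ Fm n i A j l := by linarith
        refine le_trans ?_ (sub_le_sub_right this _)
        simp only [Fm, h.sum_col, and_true]
        split_ifs <;> omega
      · refine ⟨p, hp, ?_⟩
        rw [Finset.mem_Icc] at hp
        simp only [Fm, h.sum_col]
        split_ifs <;> omega
  · simp only [eps, phi, if_true, h.sum_col, h.sum_row, h j j]
    constructor <;> split_ifs <;> omega
  · apply eps_le_and_phi_le_of_Fp _ _ _ _ _ _ hi hj <;> intro p hp <;>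
      refine ⟨p, hp, ?_⟩ <;> rw [Finset.mem_Icc] at hp <;>
      simp only [Fp, h.sum_row] <;> split_ifs <;> omega

lemma stembridge_of_eop_left {q : ℕ} (hl1 : 1 ≤ l) (hli : l < i) (hjn : j ≤ n)
    (hjl : j ≠ l) (hiq : i ≤ q) (hqn : q ≤ n)
    (hpred : ∀ p, i ≤ p → p + 1 = q → A (l + 1) p < A l q)
    (hsucc : q < n → A l (q + 1) ≤ A (l + 1) q)
    (h : IsPerturb A B l q (-1) (l + 1) q 1) :
    eps n i m j A ≤ eps n i m j B ∧ phi n i m j B ≤ phi n i m j A := by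
  have hi : 1 ≤ i := by omega
  have hin : i ≤ n := by omega
  rcases lt_trichotomy j i with hj | rfl | hj
  · apply eps_le_and_phi_le_of_Fm _ _ _ _ _ _ hin hj <;> intro p hp <;>
      refine ⟨p, hp, ?_⟩ <;> rw [Finset.mem_Icc] at hp <;>
      simp only [Fm, h.sum_col] <;> split_ifs <;> omega
  · simp only [eps, phi, if_true, h.sum_col, h.sum_row, h j j]
    constructor <;> split_ifs <;> omega
  · have hstep := Fp_succ i A j l hli
    apply eps_le_and_phi_le_of_Fp _ _ _ _ _ _ hi hj <;> intro p hp
    · by_cases hc : p = l ∧ q + 1 = j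
      · obtain ⟨rfl, rfl⟩ := hc
        have := hsucc (by omega)
        refine ⟨p + 1, by rw [Finset.mem_Icc]; omega, ?_⟩
        have : Fp i A (q + 1) p ≤ Fp i A (q + 1) (p + 1) := by
          rw [Nat.add_sub_cancel] at hstep; linarith
        refine (sub_le_sub_right this _).trans ?_
        simp only [Fp, h.sum_row]
        split_ifs <;> omega
      · refine ⟨p, hp, ?_⟩
        rw [Finset.mem_Icc] at hp
        simp only [Fp, h.sum_row]
        split_ifs <;> omega
    · by_cases hc : p = l + 1 ∧ q = j
      · obtain ⟨rfl, rfl⟩ := hc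
        have := hpred (q - 1) (by omega) (by omega)
        refine ⟨l, by rw [Finset.mem_Icc]; omega, ?_⟩
        have : Fp i A q (l + 1) + 1 ≤ Fp i A q l := by linarith
        refine le_trans ?_ (sub_le_sub_right this _)
        simp only [Fp, h.sum_row, and_true]
        split_ifs <;> omega
      · refine ⟨p, hp, ?_⟩
        rw [Finset.mem_Icc] at hp
        simp only [Fp, h.sum_row]
        split_ifs <;> omega

end

/-- First Stembridge axiom: if `e_l A ≠ 0` and `j ≠ l`, then
`ε_j(e_l A) ≥ ε_j(A)` and `φ_j(e_l A) ≤ φ_j(A)`. -/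
theorem stmt9 (n i m : ℕ) (hi : 1 ≤ i) (hin : i ≤ n) (A : Arr) (hA : InB n i m A)
    (l : ℕ) (hl : l ∈ Finset.Icc 1 n) (j : ℕ) (hj : j ∈ Finset.Icc 1 n) (hjl : j ≠ l)
    (B : Arr) (hB : eop n i m l A = some B) :
    eps n i m j A ≤ eps n i m j B ∧ phi n i m j B ≤ phi n i m j A := by
  rw [Finset.mem_Icc] at hl hj
  rw [eop] at hB
  split_ifs at hB with h0 hli hil <;> rw [Option.some.injEq] at hB
  · subst hli
    refine stembridge_of_eop_center hi hin hjl fun p q => ?_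
    subst hB
    by_cases hc : p = l ∧ q = l
    · obtain ⟨rfl, rfl⟩ := hc; simp [upd, sub_eq_add_neg]
    · simp [upd, hc]
  · have hmem := qplus_mem i A l hi
    have hq := Finset.mem_Icc.1 hmem.1
    refine stembridge_of_eop_right (q := qplus i A l) hi hil hl.2 hj.1 hjl hq.1 hq.2 ?_ ?_ ?_
    · intro p hp hpq
      have h1 := hmem.2 p (Finset.mem_Icc.2 ⟨hp, by omega⟩)
      rw [← hpq] at h1
      linarith [Fp_succ i A l p (by omega)]
    · intro hlt
      have h1 : Fp i A l (qplus i A l + 1) < Fp i A l (qplus i A l) :=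
        lt_of_sSup_maximizer_lt (Fp i A l) hi (Nat.lt_succ_self _) hlt
      linarith [Fp_succ i A l _ hlt]
    · intro p q
      subst hB
      simp only [upd]
      have : l ≠ l - 1 := by omega
      split_ifs with h1 h2 h3 <;> simp_all
      omega
  · have hli' : l < i := by omega
    have hmem := qminus_mem n i A l hin
    have hq := Finset.mem_Icc.1 hmem.1
    refine stembridge_of_eop_left (q := qminus n i A l) hl.1 hli' hj.2 hjl hq.1 hq.2 ?_ ?_ ?_
    · intro p hp hpq
      have h1 : Fm n i A l p < Fm n i A l (qminus n i A l) :=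
        lt_of_lt_sInf_maximizer (Fm n i A l) hin (by rw [← qminus]; omega) hp
      have h2 := Fm_succ n i A l p hp (by omega)
      rw [hpq] at h2
      linarith
    · intro hlt
      have h1 := hmem.2 _ (Finset.mem_Icc.2 ⟨by omega, hlt⟩)
      linarith [Fm_succ n i A l _ hq.1 hlt]
    · intro p q
      subst hB
      simp only [upd]
      split_ifs <;> simp_all
      omega

end KR
end

section
/- B^{m,i} satisfies the second Stembridge axiom: for every A ∈ B^{m,i} and l, j ∈ {1,…,n} with j ≠ l, if e_l A ≠ 0, e_j A ≠ 0 and ε_j(e_l A) = ε_j(A), then e_l e_j A = e_j e_l A ≠ 0 and, writing A' = e_l e_j A, one has φ_l(A') = φ_l(f_j A'). -/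
open Finset

namespace KR

/-- The array with a single nonzero entry `1` at position `(p,q)`. -/
def unit (p q : ℕ) : Arr := fun a b => if a = p ∧ b = q then 1 else 0

/-- The set of positions at which `e_l` and `f_l` may act. -/
def dom (n i l : ℕ) : Finset ℕ :=
  if l = i then {i} else if i < l then Icc 1 i else Icc i n

/-- The function of the position maximized by the operators of index `l`. -/
def height (n i l : ℕ) (A : Arr) (k : ℕ) : ℤ :=
  if l = i then 0 else if i < l then Fp i A l k else Fm n i A l k

/-- The amount subtracted from the maximal height to obtain `ε_l`. -/
def epsBase (n i l : ℕ) (A : Arr) : ℤ :=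
  if l = i then -A i i
  else if i < l then ∑ j ∈ Icc 1 i, A j (l - 1)
  else ∑ j ∈ Icc i n, A (l + 1) j

/-- The amount subtracted from the maximal height to obtain `φ_l`, up to the constant `m δ_{l,i}`. -/
def phiBase (n i l : ℕ) (A : Arr) : ℤ :=
  if l = i then ∑ j ∈ Icc 1 (i - 1), A j i + ∑ j ∈ Icc i n, A i j
  else if i < l then ∑ j ∈ Icc 1 i, A j l
  else ∑ j ∈ Icc i n, A l j

/-- The order in which positions are compared: increasing for `l > i`, decreasing for `l < i`. -/
def Later (i l a b : ℕ) : Prop := if i < l then a < b else b < a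

/-- `q` is the last maximizer of the height, the position at which `e_l` acts. -/
def IsEPos (n i l : ℕ) (A : Arr) (q : ℕ) : Prop :=
  q ∈ dom n i l ∧ ∀ k ∈ dom n i l, height n i l A k ≤ height n i l A q ∧
    (Later i l q k → height n i l A k < height n i l A q)

/-- `q` is the first maximizer of the height, the position at which `f_l` acts. -/
def IsFPos (n i l : ℕ) (A : Arr) (q : ℕ) : Prop :=
  q ∈ dom n i l ∧ ∀ k ∈ dom n i l, height n i l A k ≤ height n i l A q ∧
    (Later i l k q → height n i l A k < height n i l A q)

/-- The array added by `e_l` acting at position `q`. -/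
def move (i l q : ℕ) : Arr :=
  if l = i then -unit i i
  else if i < l then unit q (l - 1) - unit q l
  else unit (l + 1) q - unit l q

theorem later_trichotomy (i l : ℕ) {a b : ℕ} (h : a ≠ b) : Later i l a b ∨ Later i l b a := by
  unfold Later; split_ifs <;> omega

theorem IsEPos.unique {n i l : ℕ} {A : Arr} {q q' : ℕ} (h : IsEPos n i l A q)
    (h' : IsEPos n i l A q') : q = q' := by
  by_contra hne
  rcases later_trichotomy i l hne with hl | hl
  · exact absurd ((h.2 q' h'.1).2 hl) (not_lt.2 (h'.2 q h.1).1)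
  · exact absurd ((h'.2 q h.1).2 hl) (not_lt.2 (h.2 q' h'.1).1)

theorem IsFPos.unique {n i l : ℕ} {A : Arr} {q q' : ℕ} (h : IsFPos n i l A q)
    (h' : IsFPos n i l A q') : q = q' := by
  by_contra hne
  rcases later_trichotomy i l hne with hl | hl
  · exact absurd ((h'.2 q h.1).2 hl) (not_lt.2 (h.2 q' h'.1).1)
  · exact absurd ((h.2 q' h'.1).2 hl) (not_lt.2 (h'.2 q h.1).1)

theorem sInf_maximizers_spec {a b : ℕ} (hab : a ≤ b) (F : ℕ → ℤ) :
    let q := sInf {p | p ∈ Icc a b ∧ ∀ k ∈ Icc a b, F k ≤ F p}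
    q ∈ Icc a b ∧ ∀ k ∈ Icc a b, F k ≤ F q ∧ (k < q → F k < F q) := by
  intro q
  obtain ⟨x, hx, hmax⟩ := exists_max_image (Icc a b) F ⟨a, by simp [hab]⟩
  have hq : q ∈ {p | p ∈ Icc a b ∧ ∀ k ∈ Icc a b, F k ≤ F p} := Nat.sInf_mem ⟨x, hx, hmax⟩
  refine ⟨hq.1, fun k hk => ⟨hq.2 k hk, fun hkq => lt_of_not_ge fun hle => ?_⟩⟩
  exact Nat.notMem_of_lt_sInf hkq ⟨hk, fun r hr => (hq.2 r hr).trans hle⟩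

theorem sSup_maximizers_spec {a b : ℕ} (hab : a ≤ b) (F : ℕ → ℤ) :
    let q := sSup {p | p ∈ Icc a b ∧ ∀ k ∈ Icc a b, F k ≤ F p}
    q ∈ Icc a b ∧ ∀ k ∈ Icc a b, F k ≤ F q ∧ (q < k → F k < F q) := by
  intro q
  obtain ⟨x, hx, hmax⟩ := exists_max_image (Icc a b) F ⟨a, by simp [hab]⟩
  have hbdd : BddAbove {p | p ∈ Icc a b ∧ ∀ k ∈ Icc a b, F k ≤ F p} :=
    ⟨b, fun p hp => (mem_Icc.1 hp.1).2⟩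
  have hq : q ∈ {p | p ∈ Icc a b ∧ ∀ k ∈ Icc a b, F k ≤ F p} := Nat.sSup_mem ⟨x, hx, hmax⟩ hbdd
  refine ⟨hq.1, fun k hk => ⟨hq.2 k hk, fun hkq => lt_of_not_ge fun hle => ?_⟩⟩
  exact absurd (le_csSup hbdd ⟨hk, fun r hr => (hq.2 r hr).trans hle⟩) (not_le.2 hkq)

theorem isEPos_self (n i : ℕ) (A : Arr) : IsEPos n i i A i := by
  simp [IsEPos, dom, height, Later]

theorem isFPos_self (n i : ℕ) (A : Arr) : IsFPos n i i A i := by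
  simp [IsFPos, dom, height, Later]

theorem isEPos_qplus {n i l : ℕ} (hi : 1 ≤ i) (h : i < l) (A : Arr) :
    IsEPos n i l A (qplus i A l) := by
  simpa only [IsEPos, dom, height, Later, qplus, if_neg h.ne', if_pos h] using
    sSup_maximizers_spec hi (Fp i A l)

theorem isFPos_pplus {n i l : ℕ} (hi : 1 ≤ i) (h : i < l) (A : Arr) :
    IsFPos n i l A (pplus i A l) := by
  simpa only [IsFPos, dom, height, Later, pplus, if_neg h.ne', if_pos h] using
    sInf_maximizers_spec hi (Fp i A l)

theorem isEPos_qminus {n i l : ℕ} (hin : i ≤ n) (h : l < i) (A : Arr) :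
    IsEPos n i l A (qminus n i A l) := by
  simpa only [IsEPos, dom, height, Later, qminus, if_neg h.ne, if_neg h.not_gt] using
    sInf_maximizers_spec hin (Fm n i A l)

theorem isFPos_pminus {n i l : ℕ} (hin : i ≤ n) (h : l < i) (A : Arr) :
    IsFPos n i l A (pminus n i A l) := by
  simpa only [IsFPos, dom, height, Later, pminus, if_neg h.ne, if_neg h.not_gt] using
    sSup_maximizers_spec hin (Fm n i A l)

theorem exists_isEPos {n i : ℕ} (hi : 1 ≤ i) (hin : i ≤ n) (l : ℕ) (A : Arr) :
    ∃ q, IsEPos n i l A q := by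
  rcases lt_trichotomy l i with h | rfl | h
  · exact ⟨_, isEPos_qminus hin h A⟩
  · exact ⟨_, isEPos_self n l A⟩
  · exact ⟨_, isEPos_qplus hi h A⟩

theorem exists_isFPos {n i : ℕ} (hi : 1 ≤ i) (hin : i ≤ n) (l : ℕ) (A : Arr) :
    ∃ q, IsFPos n i l A q := by
  rcases lt_trichotomy l i with h | rfl | h
  · exact ⟨_, isFPos_pminus hin h A⟩
  · exact ⟨_, isFPos_self n l A⟩
  · exact ⟨_, isFPos_pplus hi h A⟩

theorem sum_Icc_add_sum_Icc_succ {a b q : ℕ} (f : ℕ → ℤ) (h : a ≤ q + 1) (h' : q ≤ b) :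
    ∑ j ∈ Icc a q, f j + ∑ j ∈ Icc (q + 1) b, f j = ∑ j ∈ Icc a b, f j := by
  simp only [← Ico_add_one_right_eq_Icc]
  exact sum_Ico_consecutive f h (Nat.succ_le_succ h')

theorem sum_Icc_pred_add_sum_Icc {a b q : ℕ} (f : ℕ → ℤ) (ha : 1 ≤ q) (h : a ≤ q) (h' : q ≤ b) :
    ∑ j ∈ Icc a (q - 1), f j + ∑ j ∈ Icc q b, f j = ∑ j ∈ Icc a b, f j := by
  obtain ⟨q, rfl⟩ := Nat.exists_eq_add_of_le' ha
  exact sum_Icc_add_sum_Icc_succ f h (by omega)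

theorem eps_eq {n i l : ℕ} (m : ℕ) (hi : 1 ≤ i) (hin : i ≤ n) {A : Arr} {q : ℕ}
    (h : IsEPos n i l A q) : eps n i m l A = height n i l A q - epsBase n i l A := by
  rcases lt_trichotomy l i with hl | rfl | hl
  · have hq := isEPos_qminus hin hl A
    obtain rfl := h.unique hq
    have hd := hq.1
    simp only [dom, if_neg hl.ne, if_neg hl.not_gt, mem_Icc] at hd
    have := sum_Icc_pred_add_sum_Icc (A (l + 1)) (hi.trans hd.1) hd.1 hd.2
    simp only [eps, height, epsBase, if_neg hl.ne, if_neg hl.not_gt, Fm]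
    linarith
  · simp [eps, height, epsBase]
  · have hq := isEPos_qplus (n := n) hi hl A
    obtain rfl := h.unique hq
    have hd := hq.1
    simp only [dom, if_neg hl.ne', if_pos hl, mem_Icc] at hd
    have := sum_Icc_add_sum_Icc_succ (fun j => A j (l - 1)) (by omega : 1 ≤ _ + 1) hd.2
    simp only [eps, height, epsBase, if_neg hl.ne', if_pos hl, Fp]
    linarith

theorem phi_eq_of_isFPos {n i l : ℕ} (m : ℕ) (hi : 1 ≤ i) (hin : i ≤ n) {A : Arr} {q : ℕ}
    (h : IsFPos n i l A q) :
    phi n i m l A = (if l = i then (m : ℤ) else 0) + height n i l A q - phiBase n i l A := by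
  rcases lt_trichotomy l i with hl | rfl | hl
  · have hq := isFPos_pminus hin hl A
    obtain rfl := h.unique hq
    have hd := hq.1
    simp only [dom, if_neg hl.ne, if_neg hl.not_gt, mem_Icc] at hd
    have := sum_Icc_add_sum_Icc_succ (A l) (hd.1.trans (Nat.le_succ _)) hd.2
    simp only [phi, height, phiBase, if_neg hl.ne, if_neg hl.not_gt, Fm]
    linarith
  · simp only [phi, height, phiBase, if_true]
    ring
  · have hq := isFPos_pplus (n := n) hi hl A
    obtain rfl := h.unique hq
    have hd := hq.1
    simp only [dom, if_neg hl.ne', if_pos hl, mem_Icc] at hd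
    have := sum_Icc_pred_add_sum_Icc (fun j => A j l) hd.1 hd.1 hd.2
    simp only [phi, height, phiBase, if_neg hl.ne', if_pos hl, Fp]
    linarith

theorem phi_eq {n i l : ℕ} (m : ℕ) (hi : 1 ≤ i) (hin : i ≤ n) {A : Arr} {q : ℕ}
    (h : IsEPos n i l A q) :
    phi n i m l A = (if l = i then (m : ℤ) else 0) + height n i l A q - phiBase n i l A := by
  obtain ⟨p, hp⟩ := exists_isFPos hi hin l A
  rw [phi_eq_of_isFPos m hi hin hp, le_antisymm (h.2 p hp.1).1 (hp.2 q h.1).1]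

theorem eop_eq {n i l : ℕ} (m : ℕ) (hi : 1 ≤ i) (hin : i ≤ n) {A : Arr} {q : ℕ}
    (h : IsEPos n i l A q) :
    eop n i m l A = if eps n i m l A = 0 then none else some (A + move i l q) := by
  unfold eop move
  congr 2
  rcases lt_trichotomy l i with hl | rfl | hl
  · obtain rfl := h.unique (isEPos_qminus hin hl A)
    simp only [if_neg hl.ne, if_neg hl.not_gt]
    funext a b
    simp only [upd, unit, Pi.add_apply, Pi.sub_apply]
    grind
  · simp only [if_true]
    funext a b
    simp only [upd, unit, Pi.add_apply, Pi.neg_apply]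
    grind
  · obtain rfl := h.unique (isEPos_qplus hi hl A)
    simp only [if_neg hl.ne', if_pos hl]
    funext a b
    simp only [upd, unit, Pi.add_apply, Pi.sub_apply]
    grind

theorem fop_eq {n i l : ℕ} (m : ℕ) (hi : 1 ≤ i) (hin : i ≤ n) {A : Arr} {q : ℕ}
    (h : IsFPos n i l A q) :
    fop n i m l A = if phi n i m l A = 0 then none else some (A - move i l q) := by
  unfold fop move
  congr 2
  rcases lt_trichotomy l i with hl | rfl | hl
  · obtain rfl := h.unique (isFPos_pminus hin hl A)
    simp only [if_neg hl.ne, if_neg hl.not_gt]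
    funext a b
    simp only [upd, unit, Pi.sub_apply]
    grind
  · simp only [if_true]
    funext a b
    simp only [upd, unit, Pi.sub_apply, Pi.neg_apply]
    grind
  · obtain rfl := h.unique (isFPos_pplus hi hl A)
    simp only [if_neg hl.ne', if_pos hl]
    funext a b
    simp only [upd, unit, Pi.sub_apply]
    grind

theorem height_add (n i l : ℕ) (A B : Arr) (k : ℕ) :
    height n i l (A + B) k = height n i l A k + height n i l B k := by
  unfold height Fp Fm
  split_ifs <;> simp [sum_add_distrib] <;> ring

theorem epsBase_add (n i l : ℕ) (A B : Arr) :
    epsBase n i l (A + B) = epsBase n i l A + epsBase n i l B := by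
  unfold epsBase
  split_ifs <;> simp [sum_add_distrib]
  ring

theorem phiBase_add (n i l : ℕ) (A B : Arr) :
    phiBase n i l (A + B) = phiBase n i l A + phiBase n i l B := by
  unfold phiBase
  split_ifs <;> simp [sum_add_distrib]
  ring

theorem sum_unit_left (a b p q r : ℕ) :
    ∑ j ∈ Icc a b, unit p q j r = if a ≤ p ∧ p ≤ b ∧ r = q then 1 else 0 := by
  by_cases hr : r = q
  · simp [unit, hr, sum_ite_eq', mem_Icc]
  · simp [unit, hr]

theorem sum_unit_right (a b p q r : ℕ) :
    ∑ j ∈ Icc a b, unit p q r j = if a ≤ q ∧ q ≤ b ∧ r = p then 1 else 0 := by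
  by_cases hr : r = p
  · simp [unit, hr, sum_ite_eq', mem_Icc]
  · simp [unit, hr]

theorem mem_dom_of_lt {n i l q : ℕ} (h : i < l) : q ∈ dom n i l ↔ 1 ≤ q ∧ q ≤ i := by
  simp [dom, h, h.ne']

theorem mem_dom_of_gt {n i l q : ℕ} (h : l < i) : q ∈ dom n i l ↔ i ≤ q ∧ q ≤ n := by
  simp [dom, h.not_gt, h.ne]

theorem mem_dom_self {n i q : ℕ} : q ∈ dom n i i ↔ q = i := by
  simp [dom]

theorem move_self (i q : ℕ) : move i i q = -unit i i := by simp [move]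

theorem move_of_lt {i l : ℕ} (h : i < l) (q : ℕ) :
    move i l q = unit q (l - 1) - unit q l := by simp [move, h, h.ne']

theorem move_of_gt {i l : ℕ} (h : l < i) (q : ℕ) :
    move i l q = unit (l + 1) q - unit l q := by simp [move, h.not_gt, h.ne]

theorem height_self (n i : ℕ) (A : Arr) (k : ℕ) : height n i i A k = 0 := by simp [height]

theorem height_of_lt {i l : ℕ} (h : i < l) (n : ℕ) (A : Arr) (k : ℕ) :
    height n i l A k = ∑ j ∈ Icc 1 k, A j (l - 1) + ∑ j ∈ Icc k i, A j l := by
  simp [height, Fp, h, h.ne']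

theorem height_of_gt {i l : ℕ} (h : l < i) (n : ℕ) (A : Arr) (k : ℕ) :
    height n i l A k = ∑ j ∈ Icc i k, A l j + ∑ j ∈ Icc k n, A (l + 1) j := by
  simp [height, Fm, h.not_gt, h.ne]

theorem epsBase_self (n i : ℕ) (A : Arr) : epsBase n i i A = -A i i := by simp [epsBase]

theorem epsBase_of_lt {i l : ℕ} (h : i < l) (n : ℕ) (A : Arr) :
    epsBase n i l A = ∑ j ∈ Icc 1 i, A j (l - 1) := by simp [epsBase, h, h.ne']

theorem epsBase_of_gt {i l : ℕ} (h : l < i) (n : ℕ) (A : Arr) :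
    epsBase n i l A = ∑ j ∈ Icc i n, A (l + 1) j := by simp [epsBase, h.not_gt, h.ne]

theorem phiBase_self (n i : ℕ) (A : Arr) :
    phiBase n i i A = ∑ j ∈ Icc 1 (i - 1), A j i + ∑ j ∈ Icc i n, A i j := by simp [phiBase]

theorem phiBase_of_lt {i l : ℕ} (h : i < l) (n : ℕ) (A : Arr) :
    phiBase n i l A = ∑ j ∈ Icc 1 i, A j l := by simp [phiBase, h, h.ne']

theorem phiBase_of_gt {i l : ℕ} (h : l < i) (n : ℕ) (A : Arr) :
    phiBase n i l A = ∑ j ∈ Icc i n, A l j := by simp [phiBase, h.not_gt, h.ne]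

theorem height_move_self {n i l q k : ℕ} (hq : q ∈ dom n i l) (hk : k ∈ dom n i l) :
    height n i l (move i l q) q = 0 ∧
      (Later i l k q → height n i l (move i l q) k = -1) ∧
      (Later i l q k → height n i l (move i l q) k = 1) := by
  rcases lt_trichotomy l i with h | rfl | h
  · simp only [mem_dom_of_gt h] at hq hk
    simp only [Later, if_neg h.not_gt, height_of_gt h, move_of_gt h, Pi.sub_apply, sum_sub_distrib,
      sum_unit_right]
    refine ⟨?_, fun hlt => ?_, fun hlt => ?_⟩ <;> grind
  · simp only [mem_dom_self] at hq hk
    simp [hq, hk, Later, height_self]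
  · simp only [mem_dom_of_lt h] at hq hk
    simp only [Later, if_pos h, height_of_lt h, move_of_lt h, Pi.sub_apply, sum_sub_distrib,
      sum_unit_left]
    refine ⟨?_, fun hlt => ?_, fun hlt => ?_⟩ <;> grind

theorem base_move_self {n i l q : ℕ} (hl : 1 ≤ l) (hi : 1 ≤ i) (hin : i ≤ n)
    (hq : q ∈ dom n i l) :
    epsBase n i l (move i l q) = 1 ∧ phiBase n i l (move i l q) = -1 := by
  rcases lt_trichotomy l i with h | rfl | h
  · simp only [mem_dom_of_gt h] at hq
    simp only [epsBase_of_gt h, phiBase_of_gt h, move_of_gt h, Pi.sub_apply, sum_sub_distrib,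
      sum_unit_right]
    constructor <;> grind
  · simp only [epsBase_self, phiBase_self, move_self, Pi.neg_apply, sum_neg_distrib,
      sum_unit_left, sum_unit_right]
    simp only [unit]
    constructor <;> grind
  · simp only [mem_dom_of_lt h] at hq
    simp only [epsBase_of_lt h, phiBase_of_lt h, move_of_lt h, Pi.sub_apply, sum_sub_distrib,
      sum_unit_left]
    constructor <;> grind

/-- The height normalized so that its maximum is `ε_l`. -/
def epsHeight (n i l : ℕ) (A : Arr) (k : ℕ) : ℤ := height n i l A k - epsBase n i l A

theorem epsHeight_add (n i l : ℕ) (A B : Arr) (k : ℕ) :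
    epsHeight n i l (A + B) k = epsHeight n i l A k + epsHeight n i l B k := by
  simp only [epsHeight, height_add, epsBase_add]; ring

theorem isEPos_iff {n i l : ℕ} {A : Arr} {q : ℕ} :
    IsEPos n i l A q ↔ q ∈ dom n i l ∧ ∀ k ∈ dom n i l,
      epsHeight n i l A k ≤ epsHeight n i l A q ∧
        (Later i l q k → epsHeight n i l A k < epsHeight n i l A q) := by
  simp only [IsEPos, epsHeight, sub_le_sub_iff_right, sub_lt_sub_iff_right]

/-- For adjacent indices, the change of the normalized height caused by a move. -/
theorem epsHeight_move_of_adjacent {n i l j q k : ℕ} (hl : 1 ≤ l) (hj : 1 ≤ j) (hln : l ≤ n)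
    (hjn : j ≤ n) (hjl : j = l + 1 ∨ l = j + 1) (hk : k ∈ dom n i l) (hq : q ∈ dom n i j) :
    0 ≤ epsHeight n i l (move i j q) k ∧
      epsHeight n i l (move i j q) k + epsHeight n i j (move i l k) q = 1 := by
  rcases lt_trichotomy l i with h | rfl | h
  · rcases (show j ≤ i by omega).lt_or_eq with h' | rfl
    · simp only [mem_dom_of_gt h, mem_dom_of_gt h'] at hq hk
      simp only [epsHeight, height_of_gt h, height_of_gt h', epsBase_of_gt h, epsBase_of_gt h',
        move_of_gt h, move_of_gt h', Pi.sub_apply, sum_sub_distrib, sum_unit_right]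
      grind
    · simp only [mem_dom_of_gt h, mem_dom_self] at hq hk
      simp only [epsHeight, height_of_gt h, height_self, epsBase_of_gt h, epsBase_self,
        move_of_gt h, move_self, Pi.sub_apply, Pi.neg_apply, sum_neg_distrib, sum_unit_right]
      simp only [unit]
      grind
  · rcases (show j ≠ l by omega).lt_or_gt with h' | h'
    · simp only [mem_dom_of_gt h', mem_dom_self] at hq hk
      simp only [epsHeight, height_of_gt h', height_self, epsBase_of_gt h', epsBase_self,
        move_of_gt h', move_self, Pi.sub_apply, Pi.neg_apply, sum_neg_distrib, sum_unit_right]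
      simp only [unit]
      grind
    · simp only [mem_dom_of_lt h', mem_dom_self] at hq hk
      simp only [epsHeight, height_of_lt h', height_self, epsBase_of_lt h', epsBase_self,
        move_of_lt h', move_self, Pi.sub_apply, Pi.neg_apply, sum_neg_distrib, sum_unit_left]
      simp only [unit]
      grind
  · rcases (show i ≤ j by omega).lt_or_eq with h' | rfl
    · simp only [mem_dom_of_lt h, mem_dom_of_lt h'] at hq hk
      simp only [epsHeight, height_of_lt h, height_of_lt h', epsBase_of_lt h, epsBase_of_lt h',
        move_of_lt h, move_of_lt h', Pi.sub_apply, sum_sub_distrib, sum_unit_left]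
      obtain rfl | rfl := hjl <;> constructor <;> grind
    · simp only [mem_dom_of_lt h, mem_dom_self] at hq hk
      simp only [epsHeight, height_of_lt h, height_self, epsBase_of_lt h, epsBase_self,
        move_of_lt h, move_self, Pi.sub_apply, Pi.neg_apply, sum_neg_distrib, sum_unit_left]
      simp only [unit]
      grind

theorem epsHeight_move_anti_of_adjacent {n i l j q k k' : ℕ} (hj : 1 ≤ j)
    (hjl : j = l + 1 ∨ l = j + 1) (hk : k ∈ dom n i l) (hk' : k' ∈ dom n i l)
    (hq : q ∈ dom n i j) (hkk : Later i l k k') :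
    epsHeight n i l (move i j q) k' ≤ epsHeight n i l (move i j q) k := by
  rcases lt_trichotomy l i with h | rfl | h
  · simp only [mem_dom_of_gt h, Later, if_neg h.not_gt] at hk hk' hkk
    rcases (show j ≤ i by omega).lt_or_eq with h' | rfl
    · simp only [mem_dom_of_gt h'] at hq
      simp only [epsHeight, height_of_gt h, epsBase_of_gt h,
        move_of_gt h', Pi.sub_apply, sum_sub_distrib, sum_unit_right]
      grind
    · simp only [epsHeight, height_of_gt h, epsBase_of_gt h,
        move_self, Pi.neg_apply, sum_neg_distrib, sum_unit_right]
      grind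
  · rw [mem_dom_self.1 hk, mem_dom_self.1 hk']
  · simp only [mem_dom_of_lt h, Later, if_pos h] at hk hk' hkk
    rcases (show i ≤ j by omega).lt_or_eq with h' | rfl
    · simp only [mem_dom_of_lt h'] at hq
      simp only [epsHeight, height_of_lt h, epsBase_of_lt h,
        move_of_lt h', Pi.sub_apply, sum_sub_distrib, sum_unit_left]
      grind
    · simp only [epsHeight, height_of_lt h, epsBase_of_lt h,
        move_self, Pi.neg_apply, sum_neg_distrib, sum_unit_left]
      grind

theorem base_move_of_adjacent {n i l j q : ℕ} (hl : 1 ≤ l) (hj : 1 ≤ j) (hjn : j ≤ n)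
    (hi : 1 ≤ i) (hin : i ≤ n) (hjl : j = l + 1 ∨ l = j + 1) (hq : q ∈ dom n i j) :
    phiBase n i l (move i j q) = epsBase n i l (move i j q) + 1 := by
  rcases lt_trichotomy l i with h | rfl | h
  · rcases (show j ≤ i by omega).lt_or_eq with h' | rfl
    · simp only [mem_dom_of_gt h'] at hq
      simp only [phiBase_of_gt h, epsBase_of_gt h,
        move_of_gt h', Pi.sub_apply, sum_sub_distrib, sum_unit_right]
      grind
    · simp only [phiBase_of_gt h, epsBase_of_gt h,
        move_self, Pi.neg_apply, sum_neg_distrib, sum_unit_right]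
      grind
  · rcases (show j ≠ l by omega).lt_or_gt with h' | h'
    · simp only [mem_dom_of_gt h'] at hq
      simp only [phiBase_self, epsBase_self, move_of_gt h', Pi.sub_apply, sum_sub_distrib,
        sum_unit_left, sum_unit_right]
      simp only [unit]
      grind
    · simp only [mem_dom_of_lt h'] at hq
      simp only [phiBase_self, epsBase_self, move_of_lt h', Pi.sub_apply, sum_sub_distrib,
        sum_unit_left, sum_unit_right]
      simp only [unit]
      grind
  · rcases (show i ≤ j by omega).lt_or_eq with h' | rfl
    · simp only [mem_dom_of_lt h'] at hq
      simp only [phiBase_of_lt h, epsBase_of_lt h,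
        move_of_lt h', Pi.sub_apply, sum_sub_distrib, sum_unit_left]
      grind
    · simp only [phiBase_of_lt h, epsBase_of_lt h,
        move_self, Pi.neg_apply, sum_neg_distrib, sum_unit_left]
      grind

/-- Moves with distant index on the same side of `i` do not interact. -/
theorem move_of_distant_same_side {n i l j q k : ℕ} (hj : 1 ≤ j) (hjn : j ≤ n)
    (hjl : l + 1 < j ∨ j + 1 < l) (hs : ¬(i < l ∧ j < i)) (hs' : ¬(l < i ∧ i < j)) :
    height n i l (move i j q) k = 0 ∧ epsBase n i l (move i j q) = 0 ∧
      phiBase n i l (move i j q) = 0 := by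
  rcases lt_trichotomy l i with h | rfl | h
  · rcases (show j ≤ i by omega).lt_or_eq with h' | rfl
    · simp only [height_of_gt h, phiBase_of_gt h, epsBase_of_gt h,
        move_of_gt h', Pi.sub_apply, sum_sub_distrib, sum_unit_right]
      refine ⟨?_, ?_, ?_⟩ <;> grind
    · simp only [height_of_gt h, phiBase_of_gt h, epsBase_of_gt h,
        move_self, Pi.neg_apply, sum_neg_distrib, sum_unit_right]
      refine ⟨?_, ?_, ?_⟩ <;> grind
  · rcases (show j ≠ l by omega).lt_or_gt with h' | h'
    · simp only [height_self, phiBase_self, epsBase_self, move_of_gt h', Pi.sub_apply,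
        sum_sub_distrib, sum_unit_left, sum_unit_right]
      simp only [unit]
      refine ⟨?_, ?_, ?_⟩ <;> grind
    · simp only [height_self, phiBase_self, epsBase_self, move_of_lt h', Pi.sub_apply,
        sum_sub_distrib, sum_unit_left, sum_unit_right]
      simp only [unit]
      refine ⟨?_, ?_, ?_⟩ <;> grind
  · rcases (show i ≤ j by omega).lt_or_eq with h' | rfl
    · simp only [height_of_lt h, phiBase_of_lt h, epsBase_of_lt h,
        move_of_lt h', Pi.sub_apply, sum_sub_distrib, sum_unit_left]
      refine ⟨?_, ?_, ?_⟩ <;> grind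
    · simp only [height_of_lt h, phiBase_of_lt h, epsBase_of_lt h,
        move_self, Pi.neg_apply, sum_neg_distrib, sum_unit_left]
      refine ⟨?_, ?_, ?_⟩ <;> grind

/-- Effect on the index `u > i` of a move of index `v < i`. -/
theorem move_across_of_lt {n i u v q k : ℕ} (hu : i < u) (hv : v < i) (hv1 : 1 ≤ v) :
    height n i u (move i v q) k =
        (if q = u ∧ k = v + 1 then 1 else 0) - (if q = u - 1 ∧ k = v then 1 else 0) ∧
      epsBase n i u (move i v q) = 0 ∧ phiBase n i u (move i v q) = 0 := by
  simp only [height_of_lt hu, phiBase_of_lt hu, epsBase_of_lt hu, move_of_gt hv, Pi.sub_apply,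
    sum_sub_distrib, sum_unit_left]
  refine ⟨?_, ?_, ?_⟩ <;> grind

/-- Effect on the index `v < i` of a move of index `u > i`. -/
theorem move_across_of_gt {n i u v p k : ℕ} (hu : i < u) (hv : v < i) (hun : u ≤ n) :
    height n i v (move i u p) k =
        (if p = v ∧ k = u - 1 then 1 else 0) - (if p = v + 1 ∧ k = u then 1 else 0) ∧
      epsBase n i v (move i u p) = 0 ∧ phiBase n i v (move i u p) = 0 := by
  simp only [height_of_gt hv, phiBase_of_gt hv, epsBase_of_gt hv, move_of_lt hu, Pi.sub_apply,
    sum_sub_distrib, sum_unit_right]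
  refine ⟨?_, ?_, ?_⟩ <;> grind

theorem height_succ_of_lt {i u k : ℕ} (h : i < u) (n : ℕ) (A : Arr) (hk : k < i) :
    height n i u A (k + 1) = height n i u A k + A (k + 1) (u - 1) - A k u := by
  rw [height_of_lt h, height_of_lt h, sum_Icc_succ_top (by omega),
    ← sum_Icc_add_sum_Icc_succ (fun j => A j u) k.le_succ hk.le]
  simp only [Icc_self, sum_singleton]
  ring

theorem height_succ_of_gt {n i v k : ℕ} (h : v < i) (A : Arr) (hk : i ≤ k) (hkn : k < n) :
    height n i v A (k + 1) = height n i v A k + A v (k + 1) - A (v + 1) k := by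
  rw [height_of_gt h, height_of_gt h, sum_Icc_succ_top (by omega),
    ← sum_Icc_add_sum_Icc_succ (A (v + 1)) k.le_succ hkn.le]
  simp only [Icc_self, sum_singleton]
  ring

theorem eps_nonneg {n i l : ℕ} (m : ℕ) (hi : 1 ≤ i) (hin : i ≤ n) {A : Arr}
    (hA : ∀ a b, 0 ≤ A a b) : 0 ≤ eps n i m l A := by
  obtain ⟨q, hq⟩ := exists_isEPos hi hin l A
  rw [eps_eq m hi hin hq]
  have hmax : i ∈ dom n i l := by unfold dom; split_ifs <;> simp [hi, hin]
  have h := (hq.2 i hmax).1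
  have h0 : 0 ≤ height n i l A i - epsBase n i l A := by
    rcases lt_trichotomy l i with hl | rfl | hl
    · rw [height_of_gt hl, epsBase_of_gt hl]
      simpa using hA l i
    · simpa [height_self, epsBase_self] using hA l l
    · rw [height_of_lt hl, epsBase_of_lt hl]
      simpa using hA i l
  linarith

theorem add_move_nonneg {n i l q : ℕ} (m : ℕ) (hi : 1 ≤ i) (hin : i ≤ n) {A : Arr}
    (hA : ∀ a b, 0 ≤ A a b) (hq : IsEPos n i l A q) (he : eps n i m l A ≠ 0) (a b : ℕ) :
    0 ≤ (A + move i l q) a b := by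
  have hpos := (eps_nonneg m hi hin hA).lt_of_ne' he
  rw [eps_eq m hi hin hq] at hpos
  have hab := hA a b
  rcases lt_trichotomy l i with hl | rfl | hl
  · have hp : 0 < A l q := by
      have hd := (mem_dom_of_gt hl).1 hq.1
      rcases hd.1.eq_or_lt with rfl | hlt
      · rw [height_of_gt hl, epsBase_of_gt hl] at hpos
        simpa using hpos
      · obtain ⟨k, rfl⟩ := Nat.exists_eq_add_of_le' (show 1 ≤ q by omega)
        have h1 := (hq.2 k ((mem_dom_of_gt hl).2 (by omega))).2
          (by simp only [Later, if_neg hl.not_gt]; omega)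
        rw [height_succ_of_gt hl A (by omega) (by omega)] at h1
        linarith [hA (l + 1) k]
    simp only [move_of_gt hl, Pi.add_apply, Pi.sub_apply, unit]
    grind
  · have hp : 0 < A l l := by
      simpa [height_self, epsBase_self] using hpos
    simp only [move_self, Pi.add_apply, Pi.neg_apply, unit]
    grind
  · have hp : 0 < A q l := by
      have hd := (mem_dom_of_lt hl).1 hq.1
      rcases hd.2.eq_or_lt with rfl | hlt
      · rw [height_of_lt hl, epsBase_of_lt hl] at hpos
        simpa using hpos
      · have h1 := (hq.2 (q + 1) ((mem_dom_of_lt hl).2 (by omega))).2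
          (by simp only [Later, if_pos hl]; omega)
        rw [height_succ_of_lt hl n A hlt] at h1
        linarith [hA (q + 1) (l - 1)]
    simp only [move_of_lt hl, Pi.add_apply, Pi.sub_apply, unit]
    grind

theorem phi_nonneg_of_ne {n i l : ℕ} (m : ℕ) (hi : 1 ≤ i) (hin : i ≤ n) (hl : l ≠ i) {A : Arr}
    (hA : ∀ a b, 0 ≤ A a b) : 0 ≤ phi n i m l A := by
  obtain ⟨q, hq⟩ := exists_isEPos hi hin l A
  rw [phi_eq m hi hin hq, if_neg hl]
  rcases hl.lt_or_gt with hl | hl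
  · have h := (hq.2 n ((mem_dom_of_gt hl).2 ⟨hin, le_rfl⟩)).1
    have h0 : 0 ≤ height n i l A n - phiBase n i l A := by
      rw [height_of_gt hl, phiBase_of_gt hl]
      simpa using hA (l + 1) n
    linarith
  · have h := (hq.2 1 ((mem_dom_of_lt hl).2 ⟨le_rfl, hi⟩)).1
    have h0 : 0 ≤ height n i l A 1 - phiBase n i l A := by
      rw [height_of_lt hl, phiBase_of_lt hl]
      simpa using hA 1 (l - 1)
    linarith

/-- Applying `e_l` turns the position of `e_l` into the position of `f_l`. -/
theorem IsEPos.isFPos_add_move {n i l q : ℕ} {A : Arr}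
    (hq : IsEPos n i l A q) : IsFPos n i l (A + move i l q) q := by
  refine ⟨hq.1, fun k hk => ?_⟩
  obtain ⟨h0, hlt, hgt⟩ := height_move_self hq.1 hk
  have hmax := hq.2 k hk
  rw [height_add, height_add, h0]
  refine ⟨?_, fun h => by linarith [hlt h]⟩
  by_cases hkq : k = q
  · rw [hkq, h0]
  · rcases later_trichotomy i l hkq with h | h
    · linarith [hlt h]
    · linarith [hgt h, Int.add_one_le_of_lt (hmax.2 h)]

theorem phi_add_move {n i l q : ℕ} (m : ℕ) {A : Arr} (hi : 1 ≤ i) (hin : i ≤ n) (hl : 1 ≤ l)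
    (hq : IsEPos n i l A q) :
    phi n i m l (A + move i l q) = phi n i m l A + 1 := by
  rw [phi_eq_of_isFPos m hi hin hq.isFPos_add_move, phi_eq m hi hin hq, height_add,
    phiBase_add, (height_move_self hq.1 hq.1).1, (base_move_self hl hi hin hq.1).2]
  ring

theorem fop_add_move {n i l q : ℕ} (m : ℕ) {A : Arr} (hi : 1 ≤ i) (hin : i ≤ n) (hl : 1 ≤ l)
    (hq : IsEPos n i l A q) (hphi : 0 ≤ phi n i m l A) :
    fop n i m l (A + move i l q) = some A := by
  rw [fop_eq m hi hin hq.isFPos_add_move, phi_add_move m hi hin hl hq,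
    if_neg (by omega), add_sub_cancel_right]

/-- Reachability of `(p,q)` from `(1,i)` by a lattice path along which `A` sums to `s`. -/
def ReachesWithSum (i : ℕ) (A : Arr) (p q : ℕ) (s : ℤ) : Prop :=
  ∃ L : List (ℕ × ℕ), L.head? = some (1, i) ∧ L.getLast? = some (p, q) ∧
    L.IsChain (fun β γ => γ = (β.1, β.2 + 1) ∨ γ = (β.1 + 1, β.2)) ∧
    (L.map fun β => A β.1 β.2).sum = s

theorem reachesWithSum_start (i : ℕ) (A : Arr) : ReachesWithSum i A 1 i (A 1 i) :=
  ⟨[(1, i)], by simp⟩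

theorem ReachesWithSum.step {i p q p' q' : ℕ} {A : Arr} {s : ℤ} (h : ReachesWithSum i A p q s)
    (hs : (p', q') = (p, q + 1) ∨ (p', q') = (p + 1, q)) :
    ReachesWithSum i A p' q' (s + A p' q') := by
  obtain ⟨L, hhead, hlast, hchain, hsum⟩ := h
  refine ⟨L ++ [(p', q')], ?_, by simp, ?_, by simp [hsum]⟩
  · rw [List.head?_append, hhead]; rfl
  · refine List.isChain_append.2 ⟨hchain, by simp, fun x hx y hy => ?_⟩
    rw [hlast] at hx
    simp only [Option.mem_def, Option.some.injEq, List.head?_cons] at hx hy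
    subst hx hy
    exact hs

theorem ReachesWithSum.across {i p q p' : ℕ} {A : Arr} {s : ℤ} (h : ReachesWithSum i A p q s)
    (hp : p ≤ p') : ReachesWithSum i A p' q (s + ∑ k ∈ Icc (p + 1) p', A k q) := by
  induction p', hp using Nat.le_induction with
  | base => simpa using h
  | succ r hr ih =>
    rw [sum_Icc_succ_top (by omega), ← add_assoc]
    exact ih.step (Or.inr rfl)

theorem ReachesWithSum.down {i p q q' : ℕ} {A : Arr} {s : ℤ} (h : ReachesWithSum i A p q s)
    (hq : q ≤ q') : ReachesWithSum i A p q' (s + ∑ k ∈ Icc (q + 1) q', A p k) := by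
  induction q', hq using Nat.le_induction with
  | base => simpa using h
  | succ r hr ih =>
    rw [sum_Icc_succ_top (by omega), ← add_assoc]
    exact ih.step (Or.inl rfl)

theorem InB.le_of_reachesWithSum {n i m : ℕ} {A : Arr} (hA : InB n i m A) {s : ℤ}
    (h : ReachesWithSum i A i n s) : s ≤ m := by
  obtain ⟨L, hhead, hlast, hchain, rfl⟩ := h
  exact hA.2.2 L ⟨by rintro rfl; simp at hhead, hhead, hlast, hchain⟩

theorem sum_Icc_eq_head_add {a b : ℕ} (f : ℕ → ℤ) (h : a ≤ b) :
    ∑ j ∈ Icc a b, f j = f a + ∑ j ∈ Icc (a + 1) b, f j := by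
  rw [← sum_Icc_add_sum_Icc_succ f a.le_succ h, Icc_self, sum_singleton]

theorem InB.phiBase_self_le {n i m : ℕ} {A : Arr} (hi : 1 ≤ i) (hin : i ≤ n)
    (hA : InB n i m A) : phiBase n i i A ≤ m := by
  refine le_of_eq_of_le ?_ (hA.le_of_reachesWithSum
    (((reachesWithSum_start i A).across hi).down hin))
  rw [phiBase_self, ← sum_Icc_eq_head_add (fun k => A k i) hi,
    ← sum_Icc_pred_add_sum_Icc (fun k => A k i) hi hi le_rfl, sum_Icc_eq_head_add (A i) hin]
  simp only [Icc_self, sum_singleton]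
  ring

/-- The bound coming from the path that leaves the hook through `(i,i)` at position `p`. -/
theorem InB.phiBase_add_height_le {n i m l p : ℕ} {A : Arr} (hi : 1 ≤ i)
    (hA : InB n i m A) (hl : 1 ≤ l) (hln : l ≤ n) (hli : l = i + 1 ∨ i = l + 1)
    (hp : p ∈ dom n i l) :
    phiBase n i i A + height n i l A p - height n i l A i ≤ m := by
  rcases hli with rfl | rfl
  · have h : i < i + 1 := i.lt_succ_self
    obtain ⟨hp1, hpi⟩ := (mem_dom_of_lt h).1 hp
    refine le_of_eq_of_le ?_ (hA.le_of_reachesWithSum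
      (((((reachesWithSum_start i A).across hp1).step (Or.inl rfl)).across hpi).down hln))
    rw [phiBase_self, height_of_lt h, height_of_lt h, Nat.add_sub_cancel, Icc_self,
      sum_singleton, ← sum_Icc_eq_head_add (fun k => A k i) hp1,
      ← sum_Icc_pred_add_sum_Icc (fun k => A k i) hi hi le_rfl,
      sum_Icc_eq_head_add (A i) (show i ≤ n by omega), sum_Icc_eq_head_add (A i) hln,
      sum_Icc_eq_head_add (fun k => A k (i + 1)) hpi]
    simp only [Icc_self, sum_singleton]
    ring
  · have h : l < l + 1 := l.lt_succ_self
    obtain ⟨hp1, hpn⟩ := (mem_dom_of_gt h).1 hp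
    refine le_of_eq_of_le ?_ (hA.le_of_reachesWithSum
      (((((reachesWithSum_start (l + 1) A).across hl).down hp1).step (Or.inr rfl)).down hpn))
    rw [phiBase_self, height_of_gt h, height_of_gt h, Nat.add_sub_cancel, Icc_self,
      sum_singleton, ← sum_Icc_eq_head_add (fun k => A k (l + 1)) hl,
      sum_Icc_eq_head_add (A l) hp1, sum_Icc_eq_head_add (A (l + 1)) hpn]
    ring

theorem phiBase_move_of_adjacent_center {n i l p : ℕ} (hi : 1 ≤ i) (hl : 1 ≤ l)
    (hln : l ≤ n) (hli : l = i + 1 ∨ i = l + 1) (hp : p ∈ dom n i l) :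
    phiBase n i i (move i l p) = if p = i then 0 else 1 := by
  rcases hli with rfl | rfl
  · have h : i < i + 1 := i.lt_succ_self
    simp only [mem_dom_of_lt h] at hp
    simp only [phiBase_self, move_of_lt h, Pi.sub_apply, sum_sub_distrib, sum_unit_left,
      sum_unit_right]
    grind
  · have h : l < l + 1 := l.lt_succ_self
    simp only [mem_dom_of_gt h] at hp
    simp only [phiBase_self, move_of_gt h, Pi.sub_apply, sum_sub_distrib, sum_unit_left,
      sum_unit_right]
    grind

theorem InB.nonneg {n i m : ℕ} {A : Arr} (hA : InB n i m A) (a b : ℕ) : 0 ≤ A a b := by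
  by_cases h : 1 ≤ a ∧ a ≤ i ∧ i ≤ b ∧ b ≤ n
  · exact hA.1 a b h.1 h.2.1 h.2.2.1 h.2.2.2
  · exact (hA.2.1 a b h).ge

theorem InB.phi_add_move_nonneg {n i m l j p : ℕ} {A : Arr} (hi : 1 ≤ i) (hin : i ≤ n)
    (hA : InB n i m A) (hl : 1 ≤ l) (hln : l ≤ n) (hjl : j ≠ l) (hp : IsEPos n i l A p)
    (he : eps n i m l A ≠ 0) : 0 ≤ phi n i m j (A + move i l p) := by
  by_cases hji : j = i
  swap
  · exact phi_nonneg_of_ne m hi hin hji (add_move_nonneg m hi hin hA.nonneg hp he)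
  subst hji
  rw [phi_eq m hi hin (isEPos_self n j _), if_pos rfl, height_self, phiBase_add]
  by_cases hadj : l = j + 1 ∨ j = l + 1
  · rw [phiBase_move_of_adjacent_center hi hl hln hadj hp.1]
    have hb := hA.phiBase_add_height_le hi hl hln hadj hp.1
    split_ifs with hpj
    · rw [hpj] at hb
      linarith
    · have hd : j ∈ dom n j l := by unfold dom; split_ifs <;> simp [hi, hin]
      have hlt := (hp.2 j hd).2 (by
        have := hp.1
        unfold dom at this
        unfold Later
        split_ifs at this ⊢ <;> simp only [mem_singleton, mem_Icc] at this <;> omega)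
      linarith [Int.add_one_le_of_lt hlt]
  · rw [(move_of_distant_same_side (k := j) hl hln (by omega) (by omega) (by omega)).2.2]
    linarith [hA.phiBase_self_le hi hin]

/-- Criterion for the conclusion of the second Stembridge axiom. -/
theorem stembridge_of_positions {n i m l j p q p' q' : ℕ} {A : Arr} (hi : 1 ≤ i) (hin : i ≤ n)
    (hl : 1 ≤ l) (hj : 1 ≤ j) (hp : IsEPos n i l A p)
    (hp' : IsEPos n i l (A + move i j q) p') (hq' : IsEPos n i j (A + move i l p) q')
    (hmove : move i l p + move i j q' = move i j q + move i l p')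
    (hel : eps n i m l (A + move i j q) ≠ 0) (hej : eps n i m j (A + move i l p) ≠ 0)
    (hphil : phi n i m l (A + move i j q) = phi n i m l A)
    (hphij : 0 ≤ phi n i m j (A + move i l p)) :
    ∃ A', eop n i m j (A + move i l p) = some A' ∧ eop n i m l (A + move i j q) = some A' ∧
      ∃ B, fop n i m j A' = some B ∧ phi n i m l A' = phi n i m l B := by
  have heq : A + move i l p + move i j q' = A + move i j q + move i l p' := by
    rw [add_assoc, hmove, add_assoc]
  refine ⟨A + move i l p + move i j q', ?_, ?_, A + move i l p,
    fop_add_move m hi hin hj hq' hphij, ?_⟩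
  · rw [eop_eq m hi hin hq', if_neg hej]
  · rw [eop_eq m hi hin hp', if_neg hel, heq]
  · rw [heq, phi_add_move m hi hin hl hp', phi_add_move m hi hin hl hp, hphil]

theorem IsEPos.of_height_eq_zero {n i l p : ℕ} {A B : Arr} (hp : IsEPos n i l A p)
    (hB : ∀ k, height n i l B k = 0) : IsEPos n i l (A + B) p := by
  simpa only [IsEPos, height_add, hB, add_zero] using hp

theorem stembridge_of_adjacent {n i m l j p q : ℕ} {A : Arr} (hi : 1 ≤ i) (hin : i ≤ n)
    (hA : InB n i m A) (hl : 1 ≤ l) (hln : l ≤ n) (hj : 1 ≤ j) (hjn : j ≤ n)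
    (hjl : j = l + 1 ∨ l = j + 1) (hp : IsEPos n i l A p) (hq : IsEPos n i j A q)
    (hel : eps n i m l A ≠ 0) (hej : eps n i m j A ≠ 0)
    (heps : eps n i m j (A + move i l p) = eps n i m j A) :
    ∃ A', eop n i m j (A + move i l p) = some A' ∧ eop n i m l (A + move i j q) = some A' ∧
      ∃ B, fop n i m j A' = some B ∧ phi n i m l A' = phi n i m l B := by
  obtain ⟨r, hr⟩ := exists_isEPos hi hin j (A + move i l p)
  have heps' : epsHeight n i j (A + move i l p) r = epsHeight n i j A q := by
    rwa [eps_eq m hi hin hr, eps_eq m hi hin hq] at heps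
  have hE := isEPos_iff.1 hp
  have hE' := isEPos_iff.1 hq
  have hE'' := isEPos_iff.1 hr
  have htab := fun k hk => epsHeight_move_of_adjacent (k := k) hj hl hjn hln hjl.symm hk hp.1
  have hzero : epsHeight n i j (move i l p) q = 0 := by
    have h1 := (hE''.2 q hq.1).1
    rw [heps', epsHeight_add] at h1
    linarith [(htab q hq.1).1]
  have hone : epsHeight n i l (move i j q) p = 1 := by
    linarith [(htab q hq.1).2]
  have hq' : IsEPos n i j (A + move i l p) q := by
    refine isEPos_iff.2 ⟨hq.1, fun k hk => ?_⟩
    have h1 := (hE''.2 k hk).1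
    rw [heps'] at h1
    rw [epsHeight_add _ _ _ _ _ q, hzero, add_zero]
    refine ⟨h1, fun hlt => ?_⟩
    have h2 := epsHeight_move_anti_of_adjacent hl hjl.symm hq.1 hk hp.1 hlt
    rw [epsHeight_add]
    linarith [(hE'.2 k hk).2 hlt]
  have hp' : IsEPos n i l (A + move i j q) p := by
    refine isEPos_iff.2 ⟨hp.1, fun k hk => ?_⟩
    have h1 := epsHeight_move_of_adjacent hl hj hln hjn hjl hk hq.1
    have h2 := epsHeight_move_of_adjacent hj hl hjn hln hjl.symm hq.1 hk
    rw [epsHeight_add, epsHeight_add, hone]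
    exact ⟨by linarith [(hE.2 k hk).1], fun hlt => by linarith [(hE.2 k hk).2 hlt]⟩
  refine stembridge_of_positions hi hin hl hj hp hp' hq' (add_comm _ _) ?_ (heps ▸ hej) ?_
    (hA.phi_add_move_nonneg hi hin hl hln (by omega) hp hel)
  · have h1 := eps_nonneg (l := l) m hi hin hA.nonneg
    rw [eps_eq m hi hin hp] at h1
    rw [eps_eq m hi hin hp']
    change epsHeight n i l _ p ≠ 0
    change 0 ≤ epsHeight n i l _ p at h1
    rw [epsHeight_add, hone]
    omega
  · rw [phi_eq m hi hin hp', phi_eq m hi hin hp, height_add, phiBase_add,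
      base_move_of_adjacent hl hj hjn hi hin hjl hq.1]
    unfold epsHeight at hone
    linarith

theorem stembridge_of_height_eq {n i m l j p q p' q' : ℕ} {A : Arr} (hi : 1 ≤ i) (hin : i ≤ n)
    (hA : InB n i m A) (hl : 1 ≤ l) (hln : l ≤ n) (hj : 1 ≤ j) (hjl : j ≠ l)
    (hp : IsEPos n i l A p) (hel : eps n i m l A ≠ 0) (hej : eps n i m j A ≠ 0)
    (heps : eps n i m j (A + move i l p) = eps n i m j A)
    (hp' : IsEPos n i l (A + move i j q) p') (hq' : IsEPos n i j (A + move i l p) q')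
    (hmove : move i l p + move i j q' = move i j q + move i l p')
    (hheight : height n i l (A + move i j q) p' = height n i l A p)
    (hbase : epsBase n i l (move i j q) = 0) (hbase' : phiBase n i l (move i j q) = 0) :
    ∃ A', eop n i m j (A + move i l p) = some A' ∧ eop n i m l (A + move i j q) = some A' ∧
      ∃ B, fop n i m j A' = some B ∧ phi n i m l A' = phi n i m l B := by
  refine stembridge_of_positions hi hin hl hj hp hp' hq' hmove ?_ (heps ▸ hej) ?_
    (hA.phi_add_move_nonneg hi hin hl hln hjl hp hel)
  · rwa [eps_eq m hi hin hp', epsBase_add, hheight, hbase, add_zero, ← eps_eq m hi hin hp]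
  · rw [phi_eq m hi hin hp', phi_eq m hi hin hp, phiBase_add, hheight, hbase', add_zero]

/-- The positions after interchanging moves of indices on opposite sides of `i`. -/
theorem exists_positions_across {n i u v p q : ℕ} {A : Arr} (hu : i < u) (hv : v < i)
    (hv1 : 1 ≤ v) (hun : u ≤ n) (hp : IsEPos n i u A p) (hq : IsEPos n i v A q) :
    ∃ p' q', IsEPos n i u (A + move i v q) p' ∧ IsEPos n i v (A + move i u p) q' ∧
      height n i u (A + move i v q) p' = height n i u A p ∧
      height n i v (A + move i u p) q' = height n i v A q ∧
      move i u p + move i v q' = move i v q + move i u p' := by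
  have hsu := height_succ_of_lt hu n A hv
  have hsv := height_succ_of_gt (n := n) (k := u - 1) hv A (by omega) (by omega)
  rw [Nat.sub_add_cancel (by omega : 1 ≤ u)] at hsv
  have hpd := (mem_dom_of_lt hu).1 hp.1
  have hqd := (mem_dom_of_gt hv).1 hq.1
  have hpv := hp.2 v ((mem_dom_of_lt hu).2 (by omega))
  have hpv' := hp.2 (v + 1) ((mem_dom_of_lt hu).2 (by omega))
  have hqu := hq.2 u ((mem_dom_of_gt hv).2 (by omega))
  have hqu' := hq.2 (u - 1) ((mem_dom_of_gt hv).2 (by omega))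
  have hhu := fun k => (move_across_of_lt (n := n) (q := q) (k := k) hu hv hv1).1
  have hhv := fun k => (move_across_of_gt (n := n) (p := p) (k := k) hu hv hun).1
  simp only [Later, if_pos hu, if_neg hv.not_gt] at hpv hpv' hqu hqu'
  have key : ∀ p' q', p' ∈ dom n i u → q' ∈ dom n i v →
      height n i u (A + move i v q) p' = height n i u A p →
      height n i v (A + move i u p) q' = height n i v A q →
      (∀ k ∈ dom n i u, height n i u (A + move i v q) k ≤ height n i u A p ∧
        (p' < k → height n i u (A + move i v q) k < height n i u A p)) →
      (∀ k ∈ dom n i v, height n i v (A + move i u p) k ≤ height n i v A q ∧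
        (k < q' → height n i v (A + move i u p) k < height n i v A q)) →
      IsEPos n i u (A + move i v q) p' ∧ IsEPos n i v (A + move i u p) q' := by
    intro p' q' h1 h2 h3 h4 h5 h6
    simp only [IsEPos, h3, h4, Later, if_pos hu, if_neg hv.not_gt]
    exact ⟨⟨h1, h5⟩, h2, h6⟩
  by_cases hspecial : p = v ∧ q = u ∧ height n i u A v = height n i u A (v + 1) + 1
  · obtain ⟨rfl, rfl, heq⟩ := hspecial
    have h3 : height n i q (A + move i p q) (p + 1) = height n i q A p := by
      rw [height_add, hhu]; grind
    have h4 : height n i p (A + move i q p) (q - 1) = height n i p A q := by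
      rw [height_add, hhv]; grind
    obtain ⟨h1, h2⟩ := key (p + 1) (q - 1) ((mem_dom_of_lt hu).2 (by omega))
      ((mem_dom_of_gt hv).2 (by omega)) h3 h4
      (fun k hk => by
        have := hp.2 k hk
        simp only [Later, if_pos hu] at this
        rw [height_add, hhu]; grind)
      (fun k hk => by
        have := hq.2 k hk
        simp only [Later, if_neg hv.not_gt] at this
        rw [height_add, hhv]; grind)
    refine ⟨p + 1, q - 1, h1, h2, h3, h4, ?_⟩
    simp only [move_of_lt hu, move_of_gt hv]
    abel
  · have h3 : height n i u (A + move i v q) p = height n i u A p := by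
      rw [height_add, hhu]; grind
    have h4 : height n i v (A + move i u p) q = height n i v A q := by
      rw [height_add, hhv]; grind
    obtain ⟨h1, h2⟩ := key p q hp.1 hq.1 h3 h4
      (fun k hk => by
        have := hp.2 k hk
        simp only [Later, if_pos hu] at this
        rw [height_add, hhu]; grind)
      (fun k hk => by
        have := hq.2 k hk
        simp only [Later, if_neg hv.not_gt] at this
        rw [height_add, hhv]; grind)
    exact ⟨p, q, h1, h2, h3, h4, add_comm _ _⟩

theorem eq_add_move_of_eop_eq_some {n i l q : ℕ} {m : ℕ} (hi : 1 ≤ i) (hin : i ≤ n) {A B : Arr}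
    (hq : IsEPos n i l A q) (h : eop n i m l A = some B) :
    eps n i m l A ≠ 0 ∧ B = A + move i l q := by
  rw [eop_eq m hi hin hq] at h
  split_ifs at h with h0
  exact ⟨h0, (Option.some.inj h).symm⟩

/-- Second Stembridge axiom: if `e_l A, e_j A ≠ 0` and
`ε_j(e_l A) = ε_j(A)`, then `e_l e_j A = e_j e_l A ≠ 0` and, for `A' = e_l e_j A`,
`φ_l(A') = φ_l(f_j A')`. -/
theorem stmt10 (n i m : ℕ) (hi : 1 ≤ i) (hin : i ≤ n) (A : Arr) (hA : InB n i m A)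
    (l : ℕ) (hl : l ∈ Finset.Icc 1 n) (j : ℕ) (hj : j ∈ Finset.Icc 1 n) (hjl : j ≠ l)
    (Al Aj : Arr) (hAl : eop n i m l A = some Al) (hAj : eop n i m j A = some Aj)
    (heps : eps n i m j Al = eps n i m j A) :
    ∃ A', eop n i m j Al = some A' ∧ eop n i m l Aj = some A' ∧
      ∃ B, fop n i m j A' = some B ∧ phi n i m l A' = phi n i m l B := by

  obtain ⟨hl1, hln⟩ := mem_Icc.1 hl
  obtain ⟨hj1, hjn⟩ := mem_Icc.1 hj
  obtain ⟨p, hp⟩ := exists_isEPos hi hin l A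
  obtain ⟨q, hq⟩ := exists_isEPos hi hin j A
  obtain ⟨hel, rfl⟩ := eq_add_move_of_eop_eq_some hi hin hp hAl
  obtain ⟨hej, rfl⟩ := eq_add_move_of_eop_eq_some hi hin hq hAj
  by_cases hadj : j = l + 1 ∨ l = j + 1
  · exact stembridge_of_adjacent hi hin hA hl1 hln hj1 hjn hadj hp hq hel hej heps
  by_cases hs : i < l ∧ j < i
  · obtain ⟨p', q', hp', hq', hh, -, hmove⟩ :=
      exists_positions_across hs.1 hs.2 hj1 hln hp hq
    have hb := (move_across_of_lt (n := n) (q := q) (k := i) hs.1 hs.2 hj1).2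
    exact stembridge_of_height_eq hi hin hA hl1 hln hj1 hjl hp hel hej heps hp' hq' hmove hh
      hb.1 hb.2
  by_cases hs' : l < i ∧ i < j
  · obtain ⟨q', p', hq', hp', -, hh, hmove⟩ :=
      exists_positions_across hs'.2 hs'.1 hl1 hjn hq hp
    have hb := (move_across_of_gt (n := n) (p := q) (k := i) hs'.2 hs'.1 hjn).2
    exact stembridge_of_height_eq hi hin hA hl1 hln hj1 hjl hp hel hej heps hp' hq'
      hmove.symm hh hb.1 hb.2
  have hd := fun k => move_of_distant_same_side (n := n) (q := q) (k := k) hj1 hjn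
    (show l + 1 < j ∨ j + 1 < l by omega) hs hs'
  have hd' := fun k => move_of_distant_same_side (n := n) (i := i) (q := p) (k := k) hl1 hln
    (show j + 1 < l ∨ l + 1 < j by omega) (by omega) (by omega)
  exact stembridge_of_height_eq hi hin hA hl1 hln hj1 hjl hp hel hej heps
    (hp.of_height_eq_zero fun k => (hd k).1) (hq.of_height_eq_zero fun k => (hd' k).1)
    (add_comm _ _) (by rw [height_add, (hd p).1, add_zero]) (hd p).2.1 (hd p).2.2

end KR
end
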